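/- KL bound by the Frobenius norm of the Hessian perturbation: let h : ℝ^d → ℝ be twice continuously differentiable with compact support contained in the open cube (0,1)^d and with operator norm ‖D²h(x)‖_op ≤ 1/2 for every x ∈ ℝ^d. Set φ(x) = ‖x‖₂²/2 + h(x), let P be the uniform probability measure on [0,1]^d, and let Q = (∇φ)_# P. Then KL(Q ‖ P) ≤ ∫_{[0,1]^d} ‖D²h(x)‖_F² dx, where ‖A‖_F = (Σ_{i,j} A_{ij}²)^{1/2} is the Frobenius norm. -/

import Mathlib

open MeasureTheory Set RealInnerProductSpace

lemma aux_log (z : ℝ) (hz : -(1/2) ≤ z) : z - z^2 ≤ Real.log (1+z) := by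
  have h1 : (0:ℝ) < 1 + z := by linarith
  rcases le_or_gt 0 z with h0 | h0
  · have := Real.one_sub_inv_le_log_of_pos h1
    refine le_trans ?_ this
    have : 1 - (1+z)⁻¹ - (z - z^2) = z^3 / (1+z) := by field_simp; ring
    have h3 : 0 ≤ z^3/(1+z) := by positivity
    linarith
  · have hder : ∀ y ∈ Icc (-(1/2) : ℝ) 0,
        HasDerivAt (fun y : ℝ => Real.log (1+y) - (y - y^2)) (1/(1+y) - (1 - 2*y)) y := by
      intro y hy
      have h2 : (1:ℝ) + y ≠ 0 := by have := hy.1; intro h; linarith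
      have := (((hasDerivAt_id y).const_add 1).log h2).sub ((hasDerivAt_id y).sub ((hasDerivAt_id y).pow 2))
      refine HasDerivAt.congr_deriv (f' := _) this ?_
      simp
    have hanti : AntitoneOn (fun y : ℝ => Real.log (1+y) - (y - y^2)) (Icc (-(1/2) : ℝ) 0) := by
      refine antitoneOn_of_deriv_nonpos (convex_Icc _ _)
        (fun y hy => (hder y hy).continuousAt.continuousWithinAt)
        (fun y hy => (hder y (interior_subset hy)).differentiableAt.differentiableWithinAt)
        fun y hy => ?_
      have hy' := interior_subset hy
      rw [(hder y hy').deriv]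
      have h2 : (0:ℝ) < 1 + y := by have := hy'.1; linarith
      have h3 : 1/(1+y) - (1 - 2*y) = y * (1 + 2*y)/(1+y) := by field_simp; ring
      rw [h3]
      apply div_nonpos_of_nonpos_of_nonneg _ h2.le
      exact mul_nonpos_of_nonpos_of_nonneg hy'.2 (by have := hy'.1; linarith)
    have := hanti ⟨hz, h0.le⟩ ⟨by norm_num, le_refl _⟩ h0.le
    simp at this
    linarith

lemma aux_lin {d : ℕ} (A : EuclideanSpace ℝ (Fin d) →L[ℝ] EuclideanSpace ℝ (Fin d))
    (hA : (A : EuclideanSpace ℝ (Fin d) →ₗ[ℝ] EuclideanSpace ℝ (Fin d)).IsSymmetric)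
    (hn : ‖A‖ ≤ 1/2) :
    0 < (ContinuousLinearMap.id ℝ _ + A).det ∧
    - Real.log (ContinuousLinearMap.id ℝ _ + A).det ≤
      - (∑ i, ⟪A (EuclideanSpace.single i 1), EuclideanSpace.single i 1⟫) +
      ∑ i : Fin d, ∑ j : Fin d,
            (⟪A (EuclideanSpace.single j 1), EuclideanSpace.single i 1⟫) ^ 2 := by
  have hd : Module.finrank ℝ (EuclideanSpace ℝ (Fin d)) = d := by simp
  set b := hA.eigenvectorBasis hd with hb
  set l := hA.eigenvalues hd with hl
  have hAb : ∀ i, A (b i) = l i • b i := fun i => by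
    exact hA.apply_eigenvectorBasis hd i
  have hl2 : ∀ i, |l i| ≤ 1/2 := fun i => by
    have := A.le_opNorm (b i)
    rw [hAb, norm_smul, b.norm_eq_one] at this
    simp at this
    linarith
  have hdet : (ContinuousLinearMap.id ℝ _ + A).det = ∏ i, (1 + l i) := by
    rw [ContinuousLinearMap.det, ← LinearMap.det_toMatrix b.toBasis, ← Matrix.det_diagonal]
    congr 1
    ext i j
    rw [LinearMap.toMatrix_apply]
    simp [hAb, Matrix.diagonal_apply]
    by_cases hij : i = j
    · subst hij; simp
    · simp [hij]
  let e := EuclideanSpace.basisFun (Fin d) ℝ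
  have he : ∀ i, e i = EuclideanSpace.single i 1 := fun i => by simp [e]
  have htr : ∑ i, ⟪A (EuclideanSpace.single i 1), EuclideanSpace.single i 1⟫ = ∑ i, l i := by
    have h0 := hA.trace_eq_sum_eigenvalues hd
    rw [LinearMap.trace_eq_sum_inner _ e] at h0
    refine Eq.trans ?_ h0
    refine Finset.sum_congr rfl fun i _ => ?_
    rw [he, real_inner_comm]; rfl
  have hfr : ∑ i : Fin d, ∑ j : Fin d,
      (⟪A (EuclideanSpace.single j 1), EuclideanSpace.single i 1⟫) ^ 2 = ∑ i, (l i)^2 := by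
    have h1 := LinearMap.trace_eq_sum_inner ((A : EuclideanSpace ℝ (Fin d) →ₗ[ℝ] EuclideanSpace ℝ (Fin d)) ∘ₗ A) e
    rw [LinearMap.trace_eq_sum_inner _ b] at h1
    have h2 : ∀ x, ⟪x, A (A x)⟫ = ‖A x‖^2 := fun x => by
      rw [← real_inner_self_eq_norm_sq]; exact (hA x (A x)).symm
    simp only [LinearMap.comp_apply, ContinuousLinearMap.coe_coe, h2] at h1
    rw [Finset.sum_comm]
    calc _ = ∑ j, ‖A (e j)‖^2 := by
          refine Finset.sum_congr rfl fun j _ => ?_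
          rw [← e.sum_sq_norm_inner_left (A (e j))]
          simp [he]
      _ = _ := h1.symm
      _ = _ := by
          refine Finset.sum_congr rfl fun j _ => ?_
          rw [hAb, norm_smul, b.norm_eq_one]; simp
  have hpos : ∀ i, 0 < 1 + l i := fun i => by have := (abs_le.1 (hl2 i)).1; linarith
  rw [hdet, htr, hfr]
  refine ⟨Finset.prod_pos fun i _ => hpos i, ?_⟩
  rw [Real.log_prod (fun i _ => (hpos i).ne'), ← Finset.sum_neg_distrib, ← Finset.sum_neg_distrib,
    ← Finset.sum_add_distrib]
  refine Finset.sum_le_sum fun i _ => ?_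
  have := aux_log (l i) (abs_le.1 (hl2 i)).1
  linarith

lemma aux_div {d : ℕ} (g : EuclideanSpace ℝ (Fin d) → EuclideanSpace ℝ (Fin d))
    (hg : ContDiff ℝ 1 g) (hc : HasCompactSupport g) :
    ∫ x, ∑ i, ⟪fderiv ℝ g x (EuclideanSpace.single i 1), EuclideanSpace.single i 1⟫ = 0 := by
  have hcd := hg.continuous_fderiv one_ne_zero
  have hcc := hc.fderiv ℝ
  rw [integral_finsetSum]
  · refine Finset.sum_eq_zero fun i _ => ?_
    set v : EuclideanSpace ℝ (Fin d) := EuclideanSpace.single i 1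
    have hd : ∀ x, fderiv ℝ (fun y => ⟪g y, v⟫) x v = ⟪fderiv ℝ g x v, v⟫ := fun x => by
      have h1 : DifferentiableAt ℝ g x := (hg.differentiable one_ne_zero) x
      rw [fderiv_inner_apply ℝ h1 (differentiableAt_const _)]
      simp
    have := integral_mul_fderiv_eq_neg_fderiv_mul_of_integrable (μ := volume) (𝕜 := ℝ)
      (f := fun _ : EuclideanSpace ℝ (Fin d) => (1:ℝ)) (g := fun y => ⟪g y, v⟫) (v := v) ?_ ?_ ?_ ?_ ?_
    · simpa [hd] using this
    · simp
    · simp only [hd, one_mul]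
      exact Continuous.integrable_of_hasCompactSupport (by fun_prop)
        (hcc.comp_left (g := fun L : EuclideanSpace ℝ (Fin d) →L[ℝ] EuclideanSpace ℝ (Fin d) => ⟪L v, v⟫) (by simp))
    · simp only [one_mul]
      exact Continuous.integrable_of_hasCompactSupport (by have := hg.continuous; fun_prop)
        (hc.comp_left (g := fun L : EuclideanSpace ℝ (Fin d) => ⟪L, v⟫) (by simp))
    · intro x _; exact differentiableAt_const _
    · intro x _; exact ((hg.differentiable one_ne_zero) x).inner ℝ (differentiableAt_const _)
  · intro i _
    exact Continuous.integrable_of_hasCompactSupport (by fun_prop)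
        (hcc.comp_left (g := fun L : EuclideanSpace ℝ (Fin d) →L[ℝ] EuclideanSpace ℝ (Fin d) => ⟪L (EuclideanSpace.single i 1), EuclideanSpace.single i 1⟫) (by simp))

lemma aux_grad {d : ℕ} (h : EuclideanSpace ℝ (Fin d) → ℝ) (hsm : ContDiff ℝ 2 h) :
    ContDiff ℝ 1 (gradient h) ∧
    ∀ x, (fderiv ℝ (gradient h) x : EuclideanSpace ℝ (Fin d) →ₗ[ℝ] EuclideanSpace ℝ (Fin d)).IsSymmetric := by
  have hf : ContDiff ℝ 1 (fderiv ℝ h) := hsm.fderiv_right (by norm_num)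
  let J : (EuclideanSpace ℝ (Fin d) →L[ℝ] ℝ) →L[ℝ] EuclideanSpace ℝ (Fin d) :=
    LinearMap.toContinuousLinearMap
      { toFun := fun L => (InnerProductSpace.toDual ℝ (EuclideanSpace ℝ (Fin d))).symm L
        map_add' := fun a b => map_add _ a b
        map_smul' := fun c a => by simp }
  have hJ : gradient h = fun x => J (fderiv ℝ h x) := rfl
  have hJi : ∀ L v, ⟪J L, v⟫ = L v := fun L v =>
    InnerProductSpace.toDual_symm_apply
  refine ⟨by rw [hJ]; exact J.contDiff.comp hf, fun x v w => ?_⟩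
  have hd : ∀ v, fderiv ℝ (gradient h) x v = J (fderiv ℝ (fderiv ℝ h) x v) := fun v => by
    rw [hJ]
    have := (J.hasFDerivAt.comp x ((hf.differentiable one_ne_zero) x).hasFDerivAt).fderiv
    have h2 := congrArg (fun L => L v) this
    exact h2
  have hs := (hsm.contDiffAt (x := x)).isSymmSndFDerivAt (by simp) v w
  simp only [ContinuousLinearMap.coe_coe, hd]
  rw [hJi, real_inner_comm, hJi]
  exact hs

lemma aux_T {d : ℕ} (h : EuclideanSpace ℝ (Fin d) → ℝ) (hsm : ContDiff ℝ 2 h) :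
    (gradient fun x => ‖x‖ ^ 2 / 2 + h x) = fun x => x + gradient h x := by
  funext x
  apply HasGradientAt.gradient
  have h1 : HasGradientAt h (gradient h x) x :=
    ((hsm.differentiable two_ne_zero) x).hasGradientAt
  rw [hasGradientAt_iff_hasFDerivAt] at h1 ⊢
  have h2 := ((hasStrictFDerivAt_norm_sq x).hasFDerivAt.const_mul (1/2 : ℝ)).add h1
  have h3 : (InnerProductSpace.toDual ℝ (EuclideanSpace ℝ (Fin d))) (x + gradient h x) =
      (1 / 2 : ℝ) • 2 • (innerSL ℝ) x +
        (InnerProductSpace.toDual ℝ (EuclideanSpace ℝ (Fin d))) (gradient h x) := by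
    ext v; simp [inner_add_left]
  have h4 : (fun x => ‖x‖ ^ 2 / 2 + h x) = (fun y => 1 / 2 * ‖y‖ ^ 2) + h := by
    funext y; simp; ring
  rw [h3, h4]
  exact h2

/-- pushforward density -/
lemma aux_kl {E : Type*} [NormedAddCommGroup E] [NormedSpace ℝ E] [FiniteDimensional ℝ E]
    [MeasurableSpace E] [BorelSpace E] (μ : Measure E) [μ.IsAddHaarMeasure] (T : E → E)
    (T' : E → E →L[ℝ] E) (hT : ∀ x, HasFDerivAt T (T' x) x) (hT' : Continuous T')
    (hinj : Function.Injective T) (hdet : ∀ x, 0 < (T' x).det) (C : Set E) (hC : MeasurableSet C)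
    (hTC : MapsTo T C C) :
    ∫ y, Real.log ((((μ.restrict C).map T).rnDeriv (μ.restrict C)) y).toReal ∂((μ.restrict C).map T)
      = ∫ x in C, - Real.log (T' x).det ∂μ := by
  have hTc : Continuous T := continuous_iff_continuousAt.2 fun x => (hT x).continuousAt
  have hemb : MeasurableEmbedding T := hTc.measurableEmbedding hinj
  have hdc : Continuous fun x => (T' x).det := ContinuousLinearMap.continuous_det.comp hT'
  let q : E → ENNReal := Function.extend T (fun x => (ENNReal.ofReal (T' x).det)⁻¹) 0
  have hqm : Measurable q := hemb.measurable_extend hdc.measurable.ennreal_ofReal.inv measurable_const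
  have hqT : ∀ x, q (T x) = (ENNReal.ofReal (T' x).det)⁻¹ := fun x => hinj.extend_apply _ _ _
  let r : E → ENNReal := (T '' C).indicator q
  have hTCm : MeasurableSet (T '' C) := hemb.measurableSet_image.2 hC
  have hrm : Measurable r := hqm.indicator hTCm
  have hQ : (μ.restrict C).map T = (μ.restrict C).withDensity r := by
    ext A hA
    rw [hemb.map_apply, Measure.restrict_apply (hTc.measurable hA), withDensity_apply _ hA]
    simp only [r]
    rw [← lintegral_indicator hA, indicator_indicator, lintegral_indicator (hA.inter hTCm)]
    rw [Measure.restrict_restrict (hA.inter hTCm), inter_assoc,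
      inter_eq_left.2 (image_subset_iff.2 hTC)]
    have : A ∩ T '' C = T '' (T ⁻¹' A ∩ C) := by rw [image_preimage_inter]
    rw [this, lintegral_image_eq_lintegral_abs_det_fderiv_mul μ ((hTc.measurable hA).inter hC)
      (fun x _ => (hT x).hasFDerivWithinAt) hinj.injOn]
    have h1 : ∀ x, ENNReal.ofReal |(T' x).det| * q (T x) = 1 := fun x => by
      rw [hqT, abs_of_pos (hdet x), ENNReal.mul_inv_cancel]
      · simpa using hdet x
      · simp
    simp [h1]
  have hae : ((μ.restrict C).map T).rnDeriv (μ.restrict C) =ᵐ[(μ.restrict C).map T] r := by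
    have h1 : ((μ.restrict C).withDensity r).rnDeriv (μ.restrict C) =ᵐ[μ.restrict C] r :=
      Measure.rnDeriv_withDensity _ hrm
    rw [hQ]
    exact (withDensity_absolutelyContinuous _ _).ae_le h1
  rw [integral_congr_ae (g := fun y => Real.log (r y).toReal)
    (by filter_upwards [hae] with y hy; rw [hy]), hemb.integral_map]
  refine setIntegral_congr_fun hC fun x hx => ?_
  simp only [r]
  rw [indicator_of_mem (mem_image_of_mem T hx), hqT, ENNReal.toReal_inv,
    ENNReal.toReal_ofReal (hdet x).le, Real.log_inv]

theorem kl_le_frobenius_hessian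
    (d : ℕ) (h : EuclideanSpace ℝ (Fin d) → ℝ) (hsm : ContDiff ℝ 2 h)
    (hcs : HasCompactSupport h)
    (hsupp : tsupport h ⊆ {z : EuclideanSpace ℝ (Fin d) | ∀ i, z i ∈ Set.Ioo (0 : ℝ) 1})
    (hop : ∀ x : EuclideanSpace ℝ (Fin d), ‖fderiv ℝ (gradient h) x‖ ≤ 1 / 2) :
    (∫ y, Real.log
        ((((((volume : Measure (EuclideanSpace ℝ (Fin d))).restrict
              {z | ∀ i, z i ∈ Set.Icc (0 : ℝ) 1}).map
                (gradient fun x => ‖x‖ ^ 2 / 2 + h x)).rnDeriv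
            ((volume : Measure (EuclideanSpace ℝ (Fin d))).restrict
              {z | ∀ i, z i ∈ Set.Icc (0 : ℝ) 1})) y).toReal)
        ∂(((volume : Measure (EuclideanSpace ℝ (Fin d))).restrict
            {z | ∀ i, z i ∈ Set.Icc (0 : ℝ) 1}).map
              (gradient fun x => ‖x‖ ^ 2 / 2 + h x)))
      ≤ ∫ x in {z : EuclideanSpace ℝ (Fin d) | ∀ i, z i ∈ Set.Icc (0 : ℝ) 1},
          (∑ i : Fin d, ∑ j : Fin d,
            (⟪fderiv ℝ (gradient h) x (EuclideanSpace.single j 1),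
              EuclideanSpace.single i 1⟫) ^ 2) ∂volume := by
  obtain ⟨hg, hsym⟩ := aux_grad h hsm
  rw [aux_T h hsm]
  set g := gradient h with hgdef
  set C : Set (EuclideanSpace ℝ (Fin d)) := {z | ∀ i, z i ∈ Set.Icc (0 : ℝ) 1} with hCdef
  have hCclosed : IsClosed C := by
    have : C = ⋂ i, (fun z : EuclideanSpace ℝ (Fin d) => z i) ⁻¹' Set.Icc (0:ℝ) 1 := by
      ext z; simp [C]
    rw [this]
    exact isClosed_iInter fun i => isClosed_Icc.preimage (by fun_prop)
  have hCcompact : IsCompact C := by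
    have : C = (EuclideanSpace.equiv (Fin d) ℝ).toHomeomorph ⁻¹'
        (Set.pi univ fun _ => Set.Icc (0:ℝ) 1) := by
      ext z; simp only [C, mem_setOf_eq, mem_preimage, mem_univ_pi]; rfl
    rw [this, Homeomorph.isCompact_preimage]
    exact isCompact_univ_pi fun _ => isCompact_Icc
  have hcd := hg.continuous_fderiv one_ne_zero
  have hg0 : ∀ x, x ∉ tsupport h → g x = 0 := by
    intro x hx
    have : fderiv ℝ h x = 0 := by
      by_contra hne
      exact hx (support_fderiv_subset ℝ hne)
    simp [hgdef, gradient, this]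
  have hgsupp : tsupport g ⊆ tsupport h :=
    closure_minimal (fun x hx => by_contra fun hne => hx (hg0 x hne)) (isClosed_tsupport h)
  have hgc : HasCompactSupport g := hcs.of_isClosed_subset (isClosed_tsupport _) hgsupp
  have hsuppC : tsupport h ⊆ C := fun x hx i => Ioo_subset_Icc_self (hsupp hx i)
  have hdT : ∀ x, HasFDerivAt (fun x => x + g x)
      (ContinuousLinearMap.id ℝ _ + fderiv ℝ g x) x := fun x =>
    (hasFDerivAt_id x).add ((hg.differentiable one_ne_zero) x).hasFDerivAt
  have hlip : LipschitzWith (1/2) g := by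
    refine lipschitzWith_of_nnnorm_fderiv_le (𝕜 := ℝ) (hg.differentiable one_ne_zero) fun x => ?_
    rw [← NNReal.coe_le_coe]; simpa using hop x
  have hinj : Function.Injective (fun x => x + g x) := by
    intro x y hxy
    have h1 : x - y = g y - g x := by
      simp only at hxy
      rw [sub_eq_sub_iff_add_eq_add, hxy, add_comm]
    have h2 := hlip.dist_le_mul y x
    rw [dist_eq_norm, ← h1, dist_comm, dist_eq_norm] at h2
    simp at h2
    have h3 : ‖x - y‖ = 0 := by linarith [norm_nonneg (x - y)]
    exact sub_eq_zero.1 (norm_eq_zero.1 h3)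
  have hTC : MapsTo (fun x => x + g x) C C := by
    intro x hx
    by_contra hne
    have h1 : g (x + g x) = 0 := hg0 _ fun hh => hne (hsuppC hh)
    have h2 : x + g x = x := hinj (by simp [h1])
    simp only [h2] at hne
    exact hne hx
  have hlin := fun x => aux_lin (fderiv ℝ g x) (hsym x) (hop x)
  have hT'c : Continuous fun x => ContinuousLinearMap.id ℝ (EuclideanSpace ℝ (Fin d)) + fderiv ℝ g x := by
    fun_prop
  rw [aux_kl volume _ _ hdT hT'c hinj (fun x => (hlin x).1) C hCclosed.measurableSet hTC]
  have hdc : Continuous fun x =>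
      (ContinuousLinearMap.id ℝ (EuclideanSpace ℝ (Fin d)) + fderiv ℝ g x).det :=
    ContinuousLinearMap.continuous_det.comp hT'c
  have hi1 : IntegrableOn (fun x => - Real.log
      (ContinuousLinearMap.id ℝ (EuclideanSpace ℝ (Fin d)) + fderiv ℝ g x).det) C :=
    ContinuousOn.integrableOn_compact hCcompact
      (hdc.log fun x => (hlin x).1.ne').neg.continuousOn
  have hi2 : IntegrableOn (fun x => ∑ i : Fin d,
      ⟪fderiv ℝ g x (EuclideanSpace.single i 1), EuclideanSpace.single i 1⟫) C :=
    ContinuousOn.integrableOn_compact hCcompact (Continuous.continuousOn (by fun_prop))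
  have hi3 : IntegrableOn (fun x => ∑ i : Fin d, ∑ j : Fin d,
      (⟪fderiv ℝ g x (EuclideanSpace.single j 1), EuclideanSpace.single i 1⟫) ^ 2) C :=
    ContinuousOn.integrableOn_compact hCcompact (Continuous.continuousOn (by fun_prop))
  have hz : ∫ x in C, ∑ i : Fin d,
      ⟪fderiv ℝ g x (EuclideanSpace.single i 1), EuclideanSpace.single i 1⟫ = 0 := by
    rw [setIntegral_eq_integral_of_forall_compl_eq_zero, aux_div g hg hgc]
    intro x hx
    have : fderiv ℝ g x = 0 := by
      by_contra hne
      exact hx (hsuppC (hgsupp (support_fderiv_subset ℝ hne)))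
    simp [this]
  calc _ ≤ ∫ x in C, (- (∑ i : Fin d,
      ⟪fderiv ℝ g x (EuclideanSpace.single i 1), EuclideanSpace.single i 1⟫) +
      ∑ i : Fin d, ∑ j : Fin d,
      (⟪fderiv ℝ g x (EuclideanSpace.single j 1), EuclideanSpace.single i 1⟫) ^ 2) :=
        integral_mono hi1 (hi2.neg.add hi3) fun x => (hlin x).2
    _ = _ := by
      have hi2n : IntegrableOn (fun x => - ∑ i : Fin d,
        ⟪fderiv ℝ g x (EuclideanSpace.single i 1), EuclideanSpace.single i 1⟫) C := hi2.neg
      rw [integral_add hi2n hi3, integral_neg, hz, neg_zero, zero_add]
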